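/- The entanglement of purification E_P(A:B) = inf over purifications |Ψ⟩_{AA'BB'} of ρ_{AB} of S(AA') vanishes if ρ_{AB} = ρ_A ⊗ ρ_B is a product state, and E_P(A:B) ≥ ½ I(A:B) where I(A:B) = S(A) + S(B) - S(AB) is the mutual information. -/

import Mathlib

open scoped ComplexOrder Matrix Kronecker

open Classical in
/-- Von Neumann entropy `S(ρ) = -Tr(ρ log ρ)`, computed from the eigenvalue spectrum. -/
noncomputable def vonNeumann {n : Type*} [Fintype n] [DecidableEq n]
    (ρ : Matrix n n ℂ) : ℝ :=
  if h : ρ.IsHermitian then -∑ i, h.eigenvalues i * Real.log (h.eigenvalues i) else 0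


/-- analytic -/
lemma log_compare {ι κ : Type*} [Fintype ι] [Fintype κ] (c x : ι → ℝ) (d y : κ → ℝ)
    (hx : ∀ i, 0 < x i) (hy : ∀ i, 0 < y i) (hcd : ∑ i, c i = ∑ i, d i)
    (h : ∀ s : ℝ, 0 < s → ∑ i, c i / (x i + s) ≤ ∑ i, d i / (y i + s)) :
    ∑ i, d i * Real.log (y i) ≤ ∑ i, c i * Real.log (x i) := by
  set f : ℝ → ℝ := fun s => ∑ i, d i * Real.log (y i + s) - ∑ i, c i * Real.log (x i + s) with hf
  have hder : ∀ s : ℝ, 0 ≤ s →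
      HasDerivAt f (∑ i, d i / (y i + s) - ∑ i, c i / (x i + s)) s := by
    intro s hs
    apply HasDerivAt.sub
    · apply HasDerivAt.fun_sum
      intro i _
      have := (((hasDerivAt_id s).const_add (y i)).log (by have := hy i; simp; linarith)).const_mul (d i)
      simpa [div_eq_mul_inv] using this
    · apply HasDerivAt.fun_sum
      intro i _
      have := (((hasDerivAt_id s).const_add (x i)).log (by have := hx i; simp; linarith)).const_mul (c i)
      simpa [div_eq_mul_inv] using this
  have hmono : MonotoneOn f (Set.Ici 0) := by
    apply monotoneOn_of_deriv_nonneg (convex_Ici 0)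
    · intro s hs; exact (hder s hs).continuousAt.continuousWithinAt
    · intro s hs; rw [interior_Ici] at hs
      exact (hder s (le_of_lt hs)).differentiableAt.differentiableWithinAt
    · intro s hs; rw [interior_Ici] at hs
      rw [(hder s (le_of_lt hs)).deriv]
      have := h s hs
      linarith
  have hl : ∀ a : ℝ, 0 < a → Filter.Tendsto (fun s => Real.log (a + s) - Real.log s)
      Filter.atTop (nhds 0) := by
    intro a ha
    have h1 : Filter.Tendsto (fun s : ℝ => Real.log (1 + a / s)) Filter.atTop (nhds 0) := by
      have h2 : Filter.Tendsto (fun s : ℝ => 1 + a / s) Filter.atTop (nhds (1 + 0)) :=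
        tendsto_const_nhds.add (tendsto_const_nhds.div_atTop Filter.tendsto_id)
      have h3 := (Real.continuousAt_log (x := 1 + 0) (by norm_num)).tendsto.comp h2
      simpa [Function.comp_def] using h3
    refine h1.congr' ?_
    filter_upwards [Filter.eventually_gt_atTop 0] with s hs
    rw [← Real.log_div (by positivity) (by positivity)]
    congr 1
    field_simp
    ring
  have hlim : Filter.Tendsto f Filter.atTop (nhds 0) := by
    have h1 : Filter.Tendsto (fun s => ∑ i, d i * (Real.log (y i + s) - Real.log s)
        - ∑ i, c i * (Real.log (x i + s) - Real.log s)) Filter.atTop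
        (nhds (∑ i, d i * 0 - ∑ i, c i * 0)) :=
      (tendsto_finsetSum _ fun i _ => (hl _ (hy i)).const_mul _).sub
        (tendsto_finsetSum _ fun i _ => (hl _ (hx i)).const_mul _)
    have h2 : (fun s => ∑ i, d i * (Real.log (y i + s) - Real.log s)
        - ∑ i, c i * (Real.log (x i + s) - Real.log s)) = f := by
      funext s
      simp only [mul_sub, Finset.sum_sub_distrib, ← Finset.sum_mul, hcd, hf]
      ring
    rw [h2] at h1
    simpa using h1
  have h0 : f 0 ≤ 0 := by
    refine ge_of_tendsto hlim ?_
    filter_upwards [Filter.eventually_ge_atTop 0] with s hs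
    exact hmono (by simp) hs hs
  simp [hf] at h0
  exact h0

lemma log_key {ι : Type*} [Fintype ι] (w p q : ι → ℝ) (hp : ∀ i, 0 ≤ p i)
    (hq : ∀ i, 0 ≤ q i) (hs : ∀ i, q i = 0 → w i * p i = 0) :
    ∃ x : ι → ℝ, (∀ i, 0 < x i) ∧
      (∀ s : ℝ, 0 < s → ∑ i, w i * (p i ^ 2 / (q i + s * p i)) = ∑ i, (w i * p i) / (x i + s)) ∧
      ∑ i, w i * p i * (Real.log (p i) - Real.log (q i)) =
        - ∑ i, (w i * p i) * Real.log (x i) := by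
    refine ⟨fun i => if w i * p i = 0 then 1 else q i / p i, ?_, ?_, ?_⟩
    · intro i
      dsimp only
      split_ifs with h0
      · norm_num
      · have h1 : p i ≠ 0 := fun h => h0 (by simp [h])
        have h2 : q i ≠ 0 := fun h => h0 (hs i h)
        exact div_pos (lt_of_le_of_ne (hq i) h2.symm) (lt_of_le_of_ne (hp i) h1.symm)
    · intro s hspos
      apply Finset.sum_congr rfl
      intro i _
      dsimp only
      split_ifs with h0
      · rw [h0]
        rcases mul_eq_zero.1 h0 with h | h <;> simp [h]
      · have h1 : p i ≠ 0 := fun h => h0 (by simp [h])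
        have h3 : 0 < p i := lt_of_le_of_ne (hp i) h1.symm
        have h4 := hq i
        have h5 : q i + s * p i ≠ 0 := by positivity
        have h6 : q i / p i + s ≠ 0 := by positivity
        field_simp
    · rw [← Finset.sum_neg_distrib]
      apply Finset.sum_congr rfl
      intro i _
      dsimp only
      split_ifs with h0
      · simp [h0]
      · have h1 : p i ≠ 0 := fun h => h0 (by simp [h])
        have h2 : q i ≠ 0 := fun h => h0 (hs i h)
        rw [Real.log_div h2 h1]
        ring

lemma log_compare' {ι κ : Type*} [Fintype ι] [Fintype κ] (w p q : ι → ℝ) (w' p' q' : κ → ℝ)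
    (hp : ∀ i, 0 ≤ p i) (hq : ∀ i, 0 ≤ q i)
    (hp' : ∀ i, 0 ≤ p' i) (hq' : ∀ i, 0 ≤ q' i)
    (hs : ∀ i, q i = 0 → w i * p i = 0) (hs' : ∀ i, q' i = 0 → w' i * p' i = 0)
    (htr : ∑ i, w i * p i = ∑ i, w' i * p' i)
    (h : ∀ s : ℝ, 0 < s → ∑ i, w i * (p i ^ 2 / (q i + s * p i)) ≤
      ∑ i, w' i * (p' i ^ 2 / (q' i + s * p' i))) :
    ∑ i, w i * p i * (Real.log (p i) - Real.log (q i)) ≤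
      ∑ i, w' i * p' i * (Real.log (p' i) - Real.log (q' i)) := by
  obtain ⟨x, hx, hx1, hx2⟩ := log_key w p q hp hq hs
  obtain ⟨y, hy, hy1, hy2⟩ := log_key w' p' q' hp' hq' hs'
  rw [hx2, hy2]
  have := log_compare (fun i => w i * p i) x (fun i => w' i * p' i) y hx hy htr (by
    intro s h0
    rw [← hx1 s h0, ← hy1 s h0]
    exact h s h0)
  linarith

/-! ### Entropy lemmas -/

lemma vonNeumann_eq_roots {n : Type*} [Fintype n] [DecidableEq n] (ρ : Matrix n n ℂ)
    (h : ρ.IsHermitian) :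
    vonNeumann ρ = -((ρ.charpoly.roots).map (fun z => z.re * Real.log z.re)).sum := by
  rw [vonNeumann, dif_pos h, h.roots_charpoly_eq_eigenvalues, Multiset.map_map]
  simp only [Finset.sum, Function.comp_def]
  simp

lemma vonNeumann_mul_comm {m n : Type*} [Fintype m] [DecidableEq m] [Fintype n] [DecidableEq n]
    (M : Matrix m n ℂ) : vonNeumann (M * Mᴴ) = vonNeumann (Mᴴ * M) := by
  rw [vonNeumann_eq_roots _ (Matrix.isHermitian_mul_conjTranspose_self M),
    vonNeumann_eq_roots _ (Matrix.isHermitian_conjTranspose_mul_self M)]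
  have h := congrArg Polynomial.roots (Matrix.charpoly_mul_comm' M Mᴴ)
  rw [Polynomial.roots_mul, Polynomial.roots_mul] at h
  · have h2 := congrArg (fun t => (Multiset.map (fun z : ℂ => z.re * Real.log z.re) t).sum) h
    simp only [Polynomial.roots_X_pow, Multiset.map_add, Multiset.sum_add, Multiset.map_nsmul,
      Multiset.map_singleton, Multiset.sum_nsmul, Multiset.sum_singleton] at h2
    simp at h2
    rw [h2]
  · exact ((Polynomial.monic_X_pow _).mul (Matrix.charpoly_monic _)).ne_zero
  · exact ((Polynomial.monic_X_pow _).mul (Matrix.charpoly_monic _)).ne_zero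

lemma vonNeumann_transpose {n : Type*} [Fintype n] [DecidableEq n] (ρ : Matrix n n ℂ)
    (h : ρ.IsHermitian) : vonNeumann ρᵀ = vonNeumann ρ := by
  rw [vonNeumann_eq_roots _ h, vonNeumann_eq_roots _ h.transpose, Matrix.charpoly_transpose]

lemma vonNeumann_nonneg {n : Type*} [Fintype n] [DecidableEq n] (ρ : Matrix n n ℂ)
    (h : ρ.PosSemidef) (ht : ρ.trace = 1) : 0 ≤ vonNeumann ρ := by
  rw [vonNeumann, dif_pos h.1, ← Finset.sum_neg_distrib]
  have hs : ∑ i, h.1.eigenvalues i = 1 := by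
    have := h.1.trace_eq_sum_eigenvalues
    rw [ht] at this
    have h2 := congrArg Complex.re this
    simpa using h2.symm
  apply Finset.sum_nonneg
  intro i _
  have h0 := h.eigenvalues_nonneg
  have h1 : h.1.eigenvalues i ≤ 1 := by
    rw [← hs]
    exact Finset.single_le_sum (fun j _ => h0 j) (Finset.mem_univ i)
  have := Real.log_nonpos (h0 i) h1
  have := h0 i
  nlinarith

lemma vonNeumann_pure {n : Type*} [Fintype n] [DecidableEq n] (v : n → ℂ)
    (hv : ∑ i, v i * star (v i) = 1) :
    vonNeumann (Matrix.of fun i j => v i * star (v j)) = 0 := by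
  have h1 : (Matrix.of fun i j => v i * star (v j)) =
      (Matrix.of fun i (_ : Unit) => v i) * (Matrix.of fun i (_ : Unit) => v i)ᴴ := by
    ext i j
    simp [Matrix.mul_apply]
  rw [h1, vonNeumann_mul_comm]
  have h2 : (Matrix.of fun i (_ : Unit) => v i)ᴴ * (Matrix.of fun i (_ : Unit) => v i) = 1 := by
    ext i j
    simp only [Matrix.mul_apply, Matrix.conjTranspose_apply, Matrix.of_apply]
    rw [← (by simp : (1 : ℂ) = (1 : Matrix Unit Unit ℂ) i j), ← hv]
    exact Finset.sum_congr rfl fun _ _ => mul_comm _ _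
  rw [h2, vonNeumann_eq_roots _ Matrix.isHermitian_one, Matrix.charpoly_one]
  have : (Polynomial.X - 1 : Polynomial ℂ) = Polynomial.X - Polynomial.C 1 := by simp
  simp [this, Polynomial.roots_X_sub_C]

/-! ### Diagonalizations -/

/-- `U` diagonalizes `ρ` with eigenvalues `p`. -/
structure Diagz {n : Type*} [Fintype n] [DecidableEq n] (ρ U : Matrix n n ℂ) (p : n → ℝ) :
    Prop where
  l : Uᴴ * U = 1
  r : U * Uᴴ = 1
  e : ρ = U * Matrix.diagonal (fun i => (p i : ℂ)) * Uᴴ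
  nn : ∀ i, 0 ≤ p i

lemma diagz_exists {n : Type*} [Fintype n] [DecidableEq n] (ρ : Matrix n n ℂ)
    (h : ρ.PosSemidef) : ∃ U p, Diagz ρ U p ∧ vonNeumann ρ = -∑ i, p i * Real.log (p i) := by
  refine ⟨h.1.eigenvectorUnitary, h.1.eigenvalues, ⟨?_, ?_, ?_, h.eigenvalues_nonneg⟩, ?_⟩
  · exact Unitary.coe_star_mul_self h.1.eigenvectorUnitary
  · exact Unitary.coe_mul_star_self h.1.eigenvectorUnitary
  · conv_lhs => rw [h.1.spectral_theorem, Unitary.conjStarAlgAut_apply]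
    rfl
  · rw [vonNeumann, dif_pos h.1]

lemma Diagz.kron {m n : Type*} [Fintype n] [DecidableEq n] [Fintype m] [DecidableEq m]
    {ρ U : Matrix n n ℂ} {p : n → ℝ} {σ V : Matrix m m ℂ} {q : m → ℝ}
    (h : Diagz ρ U p) (h' : Diagz σ V q) :
    Diagz (ρ ⊗ₖ σ) (U ⊗ₖ V) (fun i => p i.1 * q i.2) := by
  refine ⟨?_, ?_, ?_, fun i => mul_nonneg (h.nn _) (h'.nn _)⟩
  · rw [Matrix.conjTranspose_kronecker, ← Matrix.mul_kronecker_mul, h.l, h'.l,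
      Matrix.one_kronecker_one]
  · rw [Matrix.conjTranspose_kronecker, ← Matrix.mul_kronecker_mul, h.r, h'.r,
      Matrix.one_kronecker_one]
  · rw [h.e, h'.e, Matrix.mul_kronecker_mul, Matrix.mul_kronecker_mul,
      Matrix.diagonal_kronecker_diagonal, Matrix.conjTranspose_kronecker]
    simp

/-- the quadratic functional -/
noncomputable def gform {n : Type*} [Fintype n] (s : ℝ) (ρ σ X : Matrix n n ℂ) : ℝ :=
  2 * (X * ρ).trace.re - (σ * (X * Xᴴ)).trace.re - s * (Xᴴ * X * ρ).trace.re

lemma gform_eq {n : Type*} [Fintype n] [DecidableEq n] {ρ U : Matrix n n ℂ} {p : n → ℝ}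
    {σ V : Matrix n n ℂ} {q : n → ℝ} (h : Diagz ρ U p) (h' : Diagz σ V q) (s : ℝ)
    (Y : Matrix n n ℂ) :
    gform s ρ σ (V * Y * Uᴴ) = ∑ x : n × n,
      (2 * p x.2 * (star ((Vᴴ * U) x.1 x.2) * Y x.1 x.2).re
        - (q x.1 + s * p x.2) * Complex.normSq (Y x.1 x.2)) := by
  set D := Matrix.diagonal (fun i => (p i : ℂ)) with hD
  set E := Matrix.diagonal (fun i => (q i : ℂ)) with hE
  have e1 : (V * Y * Uᴴ * ρ).trace = ((Vᴴ * U)ᴴ * (Y * D)).trace := by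
    rw [h.e]
    calc (V * Y * Uᴴ * (U * D * Uᴴ)).trace = (V * Y * (Uᴴ * U) * D * Uᴴ).trace := by
          simp only [Matrix.mul_assoc]
      _ = _ := by
          rw [h.l, Matrix.mul_one, Matrix.trace_mul_comm]
          simp [Matrix.mul_assoc]
  have e2 : (σ * ((V * Y * Uᴴ) * (V * Y * Uᴴ)ᴴ)).trace = (Yᴴ * (E * Y)).trace := by
    rw [h'.e]
    calc (V * E * Vᴴ * ((V * Y * Uᴴ) * (V * Y * Uᴴ)ᴴ)).trace
        = (V * (E * (Vᴴ * V) * Y * (Uᴴ * U) * Yᴴ * Vᴴ)).trace := by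
          simp [Matrix.mul_assoc]
      _ = (E * Y * Yᴴ * (Vᴴ * V)).trace := by
          rw [h'.l, h.l, Matrix.trace_mul_comm]
          simp only [Matrix.mul_assoc, Matrix.mul_one, h'.l]
      _ = _ := by
          rw [h'.l, Matrix.mul_one, Matrix.trace_mul_comm]
  have e3 : ((V * Y * Uᴴ)ᴴ * (V * Y * Uᴴ) * ρ).trace = (Yᴴ * (Y * D)).trace := by
    rw [h.e]
    calc ((V * Y * Uᴴ)ᴴ * (V * Y * Uᴴ) * (U * D * Uᴴ)).trace
        = (U * (Yᴴ * (Vᴴ * V) * Y * (Uᴴ * U) * D * Uᴴ)).trace := by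
          simp [Matrix.mul_assoc]
      _ = (Yᴴ * Y * D * (Uᴴ * U)).trace := by
          rw [h'.l, h.l, Matrix.trace_mul_comm]
          simp only [Matrix.mul_assoc, Matrix.mul_one, h.l]
      _ = _ := by rw [h.l, Matrix.mul_one, Matrix.mul_assoc]
  have tr : ∀ P Q : Matrix n n ℂ, (Pᴴ * Q).trace.re = ∑ x : n × n,
      (star (P x.1 x.2) * Q x.1 x.2).re := by
    intro P Q
    rw [Fintype.sum_prod_type, Finset.sum_comm]
    simp only [Matrix.trace, Matrix.diag_apply, Matrix.mul_apply, Matrix.conjTranspose_apply,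
      Complex.re_sum]
  rw [gform, e1, e2, e3, tr, tr, tr, Finset.mul_sum, Finset.mul_sum, ← Finset.sum_sub_distrib,
    ← Finset.sum_sub_distrib]
  apply Finset.sum_congr rfl
  intro x _
  simp only [hD, hE, Matrix.mul_diagonal, Matrix.diagonal_mul]
  simp [Complex.normSq_apply]
  ring

lemma gform_le {n : Type*} [Fintype n] [DecidableEq n] {ρ U : Matrix n n ℂ} {p : n → ℝ}
    {σ V : Matrix n n ℂ} {q : n → ℝ} (h : Diagz ρ U p) (h' : Diagz σ V q) (s : ℝ) (hs : 0 < s)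
    (X : Matrix n n ℂ) :
    gform s ρ σ X ≤ ∑ x : n × n, Complex.normSq ((Vᴴ * U) x.1 x.2) *
      (p x.2 ^ 2 / (q x.1 + s * p x.2)) := by
  have hX : X = V * (Vᴴ * X * U) * Uᴴ := by
    calc X = (V * Vᴴ) * X * (U * Uᴴ) := by rw [h.r, h'.r]; simp
      _ = _ := by simp only [Matrix.mul_assoc]
  rw [hX, gform_eq h h']
  apply Finset.sum_le_sum
  intro x _
  generalize (Vᴴ * X * U) x.1 x.2 = y
  generalize (Vᴴ * U) x.1 x.2 = w
  have hp := h.nn x.2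
  have hq := h'.nn x.1
  rcases hp.eq_or_lt with h0 | h0
  · rw [← h0]
    have := Complex.normSq_nonneg y
    simp
    positivity
  · have hc : 0 < q x.1 + s * p x.2 := by positivity
    generalize q x.1 + s * p x.2 = c at hc
    rw [← mul_div_assoc, le_div_iff₀ hc]
    simp only [Complex.normSq_apply, Complex.mul_re, Complex.star_def, Complex.conj_re,
      Complex.conj_im]
    nlinarith [sq_nonneg (c * y.re - p x.2 * w.re), sq_nonneg (c * y.im - p x.2 * w.im)]

lemma gform_max {n : Type*} [Fintype n] [DecidableEq n] {ρ U : Matrix n n ℂ} {p : n → ℝ}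
    {σ V : Matrix n n ℂ} {q : n → ℝ} (h : Diagz ρ U p) (h' : Diagz σ V q) (s : ℝ) (hs : 0 < s) :
    ∃ X, gform s ρ σ X = ∑ x : n × n, Complex.normSq ((Vᴴ * U) x.1 x.2) *
      (p x.2 ^ 2 / (q x.1 + s * p x.2)) := by
  refine ⟨V * (Matrix.of fun j i => ((p i / (q j + s * p i) : ℝ) : ℂ) * (Vᴴ * U) j i) * Uᴴ, ?_⟩
  rw [gform_eq h h']
  apply Finset.sum_congr rfl
  intro x _
  simp only [Matrix.of_apply]
  generalize (Vᴴ * U) x.1 x.2 = w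
  have hp := h.nn x.2
  have hq := h'.nn x.1
  rcases hp.eq_or_lt with h0 | h0
  · rw [← h0]
    simp
  · have hc : 0 < q x.1 + s * p x.2 := by positivity
    generalize q x.1 + s * p x.2 = c at hc
    simp only [Complex.normSq_apply, Complex.mul_re, Complex.mul_im, Complex.star_def,
      Complex.conj_re, Complex.conj_im, Complex.ofReal_re, Complex.ofReal_im]
    field_simp
    ring

lemma weights_col {n : Type*} [Fintype n] [DecidableEq n] {ρ U : Matrix n n ℂ} {p : n → ℝ}
    {σ V : Matrix n n ℂ} {q : n → ℝ} (h : Diagz ρ U p) (h' : Diagz σ V q) (i : n) :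
    ∑ j, Complex.normSq ((Vᴴ * U) j i) = 1 := by
  have h1 : (Vᴴ * U)ᴴ * (Vᴴ * U) = 1 := by
    calc (Vᴴ * U)ᴴ * (Vᴴ * U) = Uᴴ * (V * Vᴴ) * U := by simp [Matrix.mul_assoc]
      _ = 1 := by rw [h'.r, Matrix.mul_one, h.l]
  have h2 := congrFun (congrFun h1 i) i
  rw [Matrix.mul_apply, Matrix.one_apply_eq] at h2
  have h3 := congrArg Complex.re h2
  rw [Complex.re_sum] at h3
  rw [Complex.one_re] at h3
  rw [← h3]
  apply Finset.sum_congr rfl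
  intro j _
  simp [Matrix.conjTranspose_apply, Complex.normSq_apply]

lemma weights_row {n : Type*} [Fintype n] [DecidableEq n] {ρ U : Matrix n n ℂ} {p : n → ℝ}
    (h : Diagz ρ U p) (V : Matrix n n ℂ) (j : n) :
    ((∑ i, Complex.normSq ((Vᴴ * U) j i) * p i : ℝ) : ℂ) = (Vᴴ * ρ * V) j j := by
  have h1 : Vᴴ * ρ * V = (Vᴴ * U) * Matrix.diagonal (fun i => (p i : ℂ)) * (Vᴴ * U)ᴴ := by
    rw [h.e]; simp [Matrix.mul_assoc]
  rw [h1, Matrix.mul_apply, Complex.ofReal_sum]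
  apply Finset.sum_congr rfl
  intro i _
  rw [Matrix.mul_diagonal, Matrix.conjTranspose_apply, Complex.ofReal_mul, Complex.normSq_eq_conj_mul_self]
  simp
  ring

/-! ### Partial traces -/

/-- Partial trace over the second factor. -/
def ptA {A B : Type*} [Fintype B] (ρ : Matrix (A × B) (A × B) ℂ) : Matrix A A ℂ :=
  Matrix.of fun a₁ a₂ => ∑ b, ρ (a₁, b) (a₂, b)

/-- Partial trace over the first factor. -/
def ptB {A B : Type*} [Fintype A] (ρ : Matrix (A × B) (A × B) ℂ) : Matrix B B ℂ :=
  Matrix.of fun b b' => ∑ a, ρ (a, b) (a, b')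

section
set_option linter.unusedSectionVars false
variable {A B : Type*} [Fintype A] [DecidableEq A] [Fintype B] [DecidableEq B]

lemma trace_ptA (ρ : Matrix (A × B) (A × B) ℂ) (Z : Matrix A A ℂ) :
    (ρ * (Z ⊗ₖ (1 : Matrix B B ℂ))).trace = (ptA ρ * Z).trace := by
  simp only [Matrix.trace, Matrix.diag_apply, Matrix.mul_apply, ptA, Matrix.of_apply,
    Fintype.sum_prod_type, Matrix.kroneckerMap_apply, Matrix.one_apply, mul_ite, mul_one, mul_zero,
    Finset.sum_ite_eq', Finset.mem_univ, if_true, Finset.sum_mul]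
  apply Finset.sum_congr rfl
  intro a _
  rw [Finset.sum_comm]

lemma trace_ptB (ρ : Matrix (A × B) (A × B) ℂ) (Z : Matrix B B ℂ) :
    (ρ * ((1 : Matrix A A ℂ) ⊗ₖ Z)).trace = (ptB ρ * Z).trace := by
  simp only [Matrix.trace, Matrix.diag_apply, Matrix.mul_apply, ptB, Matrix.of_apply,
    Fintype.sum_prod_type, Matrix.kroneckerMap_apply, Matrix.one_apply, ite_mul, one_mul, zero_mul,
    mul_ite, mul_zero, Finset.sum_mul]
  rw [Finset.sum_comm]
  apply Finset.sum_congr rfl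
  intro b _
  rw [Finset.sum_comm]
  conv_rhs => rw [Finset.sum_comm]
  rw [Finset.sum_comm]
  apply Finset.sum_congr rfl
  intro a _
  rw [Finset.sum_comm]
  apply Finset.sum_congr rfl
  intro b' _
  simp

lemma ptA_psd {ρ : Matrix (A × B) (A × B) ℂ} (h : ρ.PosSemidef) : (ptA ρ).PosSemidef := by
  have : ptA ρ = ∑ b, ρ.submatrix (fun a => (a, b)) (fun a => (a, b)) := by
    ext a a'
    simp [ptA, Matrix.sum_apply]
  rw [this]
  exact Matrix.posSemidef_sum _ fun b _ => h.submatrix _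

lemma ptB_psd {ρ : Matrix (A × B) (A × B) ℂ} (h : ρ.PosSemidef) : (ptB ρ).PosSemidef := by
  have : ptB ρ = ∑ a, ρ.submatrix (fun b => (a, b)) (fun b => (a, b)) := by
    ext b b'
    simp [ptB, Matrix.sum_apply]
  rw [this]
  exact Matrix.posSemidef_sum _ fun b _ => h.submatrix _

lemma ptA_conj (ρ : Matrix (A × B) (A × B) ℂ) (V : Matrix A A ℂ) (W : Matrix B B ℂ)
    (hW : W * Wᴴ = 1) : ptA ((V ⊗ₖ W)ᴴ * ρ * (V ⊗ₖ W)) = Vᴴ * ptA ρ * V := by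
  rw [Matrix.ext_iff_trace_mul_right]
  intro Z
  rw [← trace_ptA]
  calc ((V ⊗ₖ W)ᴴ * ρ * (V ⊗ₖ W) * (Z ⊗ₖ (1 : Matrix B B ℂ))).trace
      = ((V ⊗ₖ W)ᴴ * (ρ * ((V ⊗ₖ W) * (Z ⊗ₖ (1 : Matrix B B ℂ))))).trace := by
        simp only [Matrix.mul_assoc]
    _ = (ρ * ((V ⊗ₖ W) * (Z ⊗ₖ (1 : Matrix B B ℂ)) * (V ⊗ₖ W)ᴴ)).trace := by
        rw [Matrix.trace_mul_comm]
        simp only [Matrix.mul_assoc]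
    _ = (ptA ρ * (V * Z * Vᴴ)).trace := by
        rw [Matrix.conjTranspose_kronecker, ← Matrix.mul_kronecker_mul,
          ← Matrix.mul_kronecker_mul, Matrix.mul_one, hW, trace_ptA]
    _ = (Vᴴ * ptA ρ * V * Z).trace := by
        rw [← Matrix.mul_assoc, Matrix.trace_mul_comm]
        simp only [Matrix.mul_assoc]

lemma ptB_conj (ρ : Matrix (A × B) (A × B) ℂ) (V : Matrix A A ℂ) (W : Matrix B B ℂ)
    (hV : V * Vᴴ = 1) : ptB ((V ⊗ₖ W)ᴴ * ρ * (V ⊗ₖ W)) = Wᴴ * ptB ρ * W := by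
  rw [Matrix.ext_iff_trace_mul_right]
  intro Z
  rw [← trace_ptB]
  calc ((V ⊗ₖ W)ᴴ * ρ * (V ⊗ₖ W) * ((1 : Matrix A A ℂ) ⊗ₖ Z)).trace
      = ((V ⊗ₖ W)ᴴ * (ρ * ((V ⊗ₖ W) * ((1 : Matrix A A ℂ) ⊗ₖ Z)))).trace := by
        simp only [Matrix.mul_assoc]
    _ = (ρ * ((V ⊗ₖ W) * ((1 : Matrix A A ℂ) ⊗ₖ Z) * (V ⊗ₖ W)ᴴ)).trace := by
        rw [Matrix.trace_mul_comm]
        simp only [Matrix.mul_assoc]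
    _ = (ptB ρ * (W * Z * Wᴴ)).trace := by
        rw [Matrix.conjTranspose_kronecker, ← Matrix.mul_kronecker_mul,
          ← Matrix.mul_kronecker_mul, Matrix.mul_one, hV, trace_ptB]
    _ = (Wᴴ * ptB ρ * W * Z).trace := by
        rw [← Matrix.mul_assoc, Matrix.trace_mul_comm]
        simp only [Matrix.mul_assoc]

lemma Diagz.conj {n : Type*} [Fintype n] [DecidableEq n] {ρ U : Matrix n n ℂ} {p : n → ℝ}
    (h : Diagz ρ U p) : Uᴴ * ρ * U = Matrix.diagonal (fun i => (p i : ℂ)) := by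
  rw [h.e]
  calc Uᴴ * (U * Matrix.diagonal (fun i => (p i : ℂ)) * Uᴴ) * U
      = (Uᴴ * U) * Matrix.diagonal (fun i => (p i : ℂ)) * (Uᴴ * U) := by
        simp only [Matrix.mul_assoc]
    _ = _ := by rw [h.l]; simp

lemma Diagz.trace {n : Type*} [Fintype n] [DecidableEq n] {ρ U : Matrix n n ℂ} {p : n → ℝ}
    (h : Diagz ρ U p) : ∑ i, p i = ρ.trace.re := by
  rw [h.e, Matrix.trace_mul_comm, ← Matrix.mul_assoc, h.l]
  simp [Matrix.trace_diagonal]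

lemma mi_eval {ρ U : Matrix (A × B) (A × B) ℂ} {p : A × B → ℝ} (h : Diagz ρ U p)
    {VA : Matrix A A ℂ} {α : A → ℝ} (hA : Diagz (ptA ρ) VA α)
    {VB : Matrix B B ℂ} {β : B → ℝ} (hB : Diagz (ptB ρ) VB β)
    (w : (A × B) × (A × B) → ℝ)
    (hw : w = fun x => Complex.normSq (((VA ⊗ₖ VB)ᴴ * U) x.1 x.2)) :
    (∀ x, α x.1.1 * β x.1.2 = 0 → w x * p x.2 = 0) ∧
    (∑ x, w x * p x.2 = ρ.trace.re) ∧
    ∑ x, w x * p x.2 * (Real.log (p x.2) - Real.log (α x.1.1 * β x.1.2)) =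
      ∑ i, p i * Real.log (p i) - ∑ k, α k * Real.log (α k) - ∑ l, β l * Real.log (β l) := by
  have hcol : ∀ i, ∑ j, w (j, i) = 1 := by
    intro i; rw [hw]; exact weights_col h (hA.kron hB) i
  set R : A × B → ℝ := fun j => ∑ i, w (j, i) * p i with hR
  have hrow : ∀ j, (R j : ℂ) = ((VA ⊗ₖ VB)ᴴ * ρ * (VA ⊗ₖ VB)) j j := by
    intro j
    rw [← weights_row h, hR, hw]
  have hRA : ∀ k, ∑ l, R (k, l) = α k := by
    intro k
    apply Complex.ofReal_injective
    have := congrFun (congrFun (ptA_conj ρ VA VB hB.r) k) k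
    rw [hA.conj, Matrix.diagonal_apply_eq] at this
    rw [← this, Complex.ofReal_sum, ptA, Matrix.of_apply]
    exact Finset.sum_congr rfl fun l _ => hrow _
  have hRB : ∀ l, ∑ k, R (k, l) = β l := by
    intro l
    apply Complex.ofReal_injective
    have := congrFun (congrFun (ptB_conj ρ VA VB hA.r) l) l
    rw [hB.conj, Matrix.diagonal_apply_eq] at this
    rw [← this, Complex.ofReal_sum, ptB, Matrix.of_apply]
    exact Finset.sum_congr rfl fun l _ => hrow _
  have hwn : ∀ x, 0 ≤ w x := by intro x; rw [hw]; exact Complex.normSq_nonneg _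
  have hwp : ∀ j i, 0 ≤ w (j, i) * p i := fun j i => mul_nonneg (hwn _) (h.nn i)
  have hRn : ∀ j, 0 ≤ R j := fun j => Finset.sum_nonneg fun i _ => hwp j i
  have hR0 : ∀ j : A × B, α j.1 * β j.2 = 0 → R j = 0 := by
    rintro ⟨k, l⟩ h0
    rcases mul_eq_zero.1 h0 with h1 | h1
    · rw [← hRA] at h1
      exact (Finset.sum_eq_zero_iff_of_nonneg fun l _ => hRn (k, l)).1 h1 l (Finset.mem_univ _)
    · rw [← hRB] at h1
      exact (Finset.sum_eq_zero_iff_of_nonneg fun k _ => hRn (k, l)).1 h1 k (Finset.mem_univ _)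
  refine ⟨?_, ?_, ?_⟩
  · rintro ⟨j, i⟩ h0
    exact (Finset.sum_eq_zero_iff_of_nonneg fun i _ => hwp j i).1 (hR0 j h0) i (Finset.mem_univ _)
  · rw [← h.trace, Fintype.sum_prod_type, Finset.sum_comm]
    apply Finset.sum_congr rfl
    intro i _
    dsimp only
    rw [← Finset.sum_mul, hcol, one_mul]
  · simp only [mul_sub, Finset.sum_sub_distrib]
    have e1 : ∑ x : (A × B) × (A × B), w x * p x.2 * Real.log (p x.2) =
        ∑ i, p i * Real.log (p i) := by
      rw [Fintype.sum_prod_type, Finset.sum_comm]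
      apply Finset.sum_congr rfl
      intro i _
      simp only [mul_assoc]
      rw [← Finset.sum_mul, hcol, one_mul]
    have e2 : ∑ x : (A × B) × (A × B), w x * p x.2 * Real.log (α x.1.1 * β x.1.2) =
        ∑ k, α k * Real.log (α k) + ∑ l, β l * Real.log (β l) := by
      rw [Fintype.sum_prod_type]
      have : ∀ j : A × B, ∑ i, w (j, i) * p i * Real.log (α j.1 * β j.2) =
          R j * Real.log (α j.1) + R j * Real.log (β j.2) := by
        intro j
        rw [← Finset.sum_mul]
        change R j * _ = _
        by_cases h0 : α j.1 * β j.2 = 0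
        · rw [hR0 j h0]; simp
        · rw [Real.log_mul (left_ne_zero_of_mul h0) (right_ne_zero_of_mul h0), mul_add]
      simp only [this, Finset.sum_add_distrib]
      congr 1
      · rw [Fintype.sum_prod_type]
        apply Finset.sum_congr rfl
        intro k _
        dsimp only
        rw [← Finset.sum_mul, hRA]
      · rw [Fintype.sum_prod_type, Finset.sum_comm]
        apply Finset.sum_congr rfl
        intro k _
        dsimp only
        rw [← Finset.sum_mul, hRB]
    rw [e1, e2]
    ring

/-- Monotonicity of mutual information under partial traces on both sides. -/
theorem mi_mono {A' B' : Type*} [Fintype A'] [DecidableEq A'] [Fintype B'] [DecidableEq B']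
    (R : Matrix ((A × A') × (B × B')) ((A × A') × (B × B')) ℂ) (hR : R.PosSemidef)
    (ρ : Matrix (A × B) (A × B) ℂ) (hρ : ρ.PosSemidef)
    (hρR : ∀ a a' b b', ∑ p, ∑ q, R ((a, p), (b, q)) ((a', p), (b', q)) = ρ (a, b) (a', b')) :
    vonNeumann (ptA ρ) + vonNeumann (ptB ρ) - vonNeumann ρ ≤
      vonNeumann (ptA R) + vonNeumann (ptB R) - vonNeumann R := by
  obtain ⟨U, p, hU, hS⟩ := diagz_exists ρ hρ
  obtain ⟨VA, α, hA, hSA⟩ := diagz_exists _ (ptA_psd hρ)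
  obtain ⟨VB, β, hB, hSB⟩ := diagz_exists _ (ptB_psd hρ)
  obtain ⟨U', p', hU', hS'⟩ := diagz_exists R hR
  obtain ⟨VA', α', hA', hSA'⟩ := diagz_exists _ (ptA_psd hR)
  obtain ⟨VB', β', hB', hSB'⟩ := diagz_exists _ (ptB_psd hR)
  obtain ⟨s1, t1, v1⟩ := mi_eval hU hA hB _ rfl
  obtain ⟨s2, t2, v2⟩ := mi_eval hU' hA' hB' _ rfl
  let e : (A × A') × (B × B') ≃ (A × B) × (A' × B') := Equiv.prodProdProdComm A A' B B'
  let φ : Matrix (A × B) (A × B) ℂ → Matrix ((A × A') × (B × B')) ((A × A') × (B × B')) ℂ :=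
    fun X => (X ⊗ₖ (1 : Matrix (A' × B') (A' × B') ℂ)).submatrix e e
  have hφ : ∀ (M : Matrix ((A × A') × (B × B')) ((A × A') × (B × B')) ℂ) Z,
      (M * φ Z).trace = (ptA (M.submatrix e.symm e.symm) * Z).trace := by
    intro M Z
    rw [← trace_ptA]
    have : M * φ Z = ((M.submatrix e.symm e.symm) *
        (Z ⊗ₖ (1 : Matrix (A' × B') (A' × B') ℂ))).submatrix e e := by
      rw [← Matrix.submatrix_mul_equiv _ _ e e e]
      simp [φ]
    rw [this]
    simp only [Matrix.trace, Matrix.diag_apply, Matrix.submatrix_apply]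
    exact Equiv.sum_comp e (fun i => ((M.submatrix e.symm e.symm) *
        (Z ⊗ₖ (1 : Matrix (A' × B') (A' × B') ℂ))) i i)
  have hφm : ∀ X Y, φ X * φ Y = φ (X * Y) := by
    intro X Y
    simp only [φ]
    rw [Matrix.submatrix_mul_equiv, ← Matrix.mul_kronecker_mul, Matrix.mul_one]
  have hφs : ∀ X, (φ X)ᴴ = φ Xᴴ := by
    intro X
    simp only [φ]
    rw [Matrix.conjTranspose_submatrix, Matrix.conjTranspose_kronecker, Matrix.conjTranspose_one]
  have hTR : ptA (R.submatrix e.symm e.symm) = ρ := by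
    ext ⟨a, b⟩ ⟨a', b'⟩
    rw [← hρR, ptA, Matrix.of_apply, Fintype.sum_prod_type]
    rfl
  have hTS : ptA ((ptA R ⊗ₖ ptB R).submatrix e.symm e.symm) = ptA ρ ⊗ₖ ptB ρ := by
    ext ⟨a, b⟩ ⟨a', b'⟩
    have l : ptA ((ptA R ⊗ₖ ptB R).submatrix e.symm e.symm) (a, b) (a', b') =
        ∑ x : A', ∑ y : B', ptA R (a, x) (a', x) * ptB R (b, y) (b', y) := by
      rw [ptA, Matrix.of_apply, Fintype.sum_prod_type]
      rfl
    rw [l, Matrix.kroneckerMap_apply, ← Finset.sum_mul_sum]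
    congr 1
    · simp only [ptA, Matrix.of_apply, ← hρR, Fintype.sum_prod_type]
      rw [Finset.sum_comm]
    · simp only [ptB, Matrix.of_apply, ← hρR, Fintype.sum_prod_type]
      rw [Finset.sum_comm]
      apply Finset.sum_congr rfl
      intro a _
      rw [Finset.sum_comm]
  have hg : ∀ s X, gform s R (ptA R ⊗ₖ ptB R) (φ X) = gform s ρ (ptA ρ ⊗ₖ ptB ρ) X := by
    intro s X
    rw [gform, gform, hφs, hφm, hφm, hφ, hTS, Matrix.trace_mul_comm (φ X), hφ,
      Matrix.trace_mul_comm (φ _), hφ, hTR, Matrix.trace_mul_comm ρ, Matrix.trace_mul_comm ρ]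
  have htr : ρ.trace = R.trace := by
    have := hφ R 1
    rw [hTR, Matrix.mul_one] at this
    rw [← this]
    simp [φ]
  have main := log_compare' _ (fun x : (A × B) × (A × B) => p x.2)
    (fun x => α x.1.1 * β x.1.2) _
    (fun x : ((A × A') × (B × B')) × ((A × A') × (B × B')) => p' x.2)
    (fun x => α' x.1.1 * β' x.1.2) (fun x => hU.nn _)
    (fun x => mul_nonneg (hA.nn _) (hB.nn _)) (fun x => hU'.nn _)
    (fun x => mul_nonneg (hA'.nn _) (hB'.nn _)) s1 s2 (by rw [t1, t2, htr]) (by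
      intro s hs
      obtain ⟨X, hX⟩ := gform_max hU (hA.kron hB) s hs
      rw [← hX, ← hg]
      exact gform_le hU' (hA'.kron hB') s hs _)
  rw [v1, v2] at main
  rw [hS, hSA, hSB, hS', hSA', hSB']
  linarith

end

lemma psd_factor {n : Type*} [Fintype n] [DecidableEq n] (ρ : Matrix n n ℂ)
    (h : ρ.PosSemidef) : ∃ C : Matrix n (Fin (Fintype.card n)) ℂ,
      ∀ i j, ∑ k, C i k * star (C j k) = ρ i j := by
  obtain ⟨U, p, hU, -⟩ := diagz_exists ρ h
  refine ⟨Matrix.of fun i k => U i ((Fintype.equivFin n).symm k) *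
    ((Real.sqrt (p ((Fintype.equivFin n).symm k)) : ℝ) : ℂ), ?_⟩
  intro i j
  simp only [Matrix.of_apply]
  rw [Equiv.sum_comp (Fintype.equivFin n).symm (fun k => U i k * ((Real.sqrt (p k) : ℝ) : ℂ) *
    star (U j k * ((Real.sqrt (p k) : ℝ) : ℂ)))]
  rw [hU.e, Matrix.mul_apply]
  apply Finset.sum_congr rfl
  intro k _
  rw [Matrix.mul_diagonal, Matrix.conjTranspose_apply]
  have : ((p k : ℝ) : ℂ) = ((Real.sqrt (p k) : ℝ) : ℂ) * ((Real.sqrt (p k) : ℝ) : ℂ) := by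
    rw [← Complex.ofReal_mul, Real.mul_self_sqrt (hU.nn k)]
  rw [this, star_mul']
  simp
  ring

section
variable {A B : Type*} [Fintype A] [DecidableEq A] [Fintype B] [DecidableEq B]

/-- For a purification, the reduced state has trace one and the lower bound holds. -/
lemma purif_bound {ρ : Matrix (A × B) (A × B) ℂ} (hρ : ρ.PosSemidef) (htr : ρ.trace = 1)
    {A' B' : Type*} [Fintype A'] [DecidableEq A'] [Fintype B'] [DecidableEq B']
    (Ψ : (A × A') × (B × B') → ℂ)
    (hΨ : ∀ (a a' : A) (b b' : B), (∑ p : A', ∑ q : B',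
          Ψ ((a, p), (b, q)) * star (Ψ ((a', p), (b', q)))) = ρ (a, b) (a', b')) :
    0 ≤ vonNeumann (Matrix.of fun (r s : A × A') => ∑ t : B × B', Ψ (r, t) * star (Ψ (s, t))) ∧
    (vonNeumann (ptA ρ) + vonNeumann (ptB ρ) - vonNeumann ρ) / 2 ≤
      vonNeumann (Matrix.of fun (r s : A × A') => ∑ t : B × B', Ψ (r, t) * star (Ψ (s, t))) := by
  set N : Matrix (A × A') (B × B') ℂ := Matrix.of fun r t => Ψ (r, t) with hN
  have e1 : (Matrix.of fun (r s : A × A') => ∑ t : B × B', Ψ (r, t) * star (Ψ (s, t)))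
      = N * Nᴴ := by
    ext r s
    simp [hN, Matrix.mul_apply]
  have hnorm : ∑ x, Ψ x * star (Ψ x) = 1 := by
    rw [← htr, Matrix.trace]
    simp only [Matrix.diag_apply, Fintype.sum_prod_type, ← hΨ]
    apply Finset.sum_congr rfl
    intro a _
    rw [Finset.sum_comm]
  set R : Matrix ((A × A') × (B × B')) ((A × A') × (B × B')) ℂ :=
    Matrix.of fun x y => Ψ x * star (Ψ y) with hR
  have hRp : R.PosSemidef := by
    have := Matrix.posSemidef_vecMulVec_self_star Ψ
    exact this
  have hRA : ptA R = N * Nᴴ := by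
    ext r s
    simp [ptA, hR, hN, Matrix.mul_apply]
  have hRB : ptB R = (Nᴴ * N)ᵀ := by
    ext r s
    simp [ptB, hR, hN, Matrix.mul_apply, mul_comm]
  have hS : vonNeumann (ptB R) = vonNeumann (N * Nᴴ) := by
    rw [hRB, vonNeumann_transpose _ (Matrix.isHermitian_conjTranspose_mul_self N),
      vonNeumann_mul_comm]
  have h0 : vonNeumann R = 0 := vonNeumann_pure Ψ hnorm
  have hm := mi_mono R hRp ρ hρ (fun a a' b b' => hΨ a a' b b')
  rw [e1]
  constructor
  · apply vonNeumann_nonneg _ (Matrix.posSemidef_self_mul_conjTranspose N)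
    rw [← e1, ← hnorm, Matrix.trace]
    simp only [Matrix.diag_apply, Matrix.of_apply, Fintype.sum_prod_type]
  · rw [hS, hRA, h0] at hm
    linarith

end

/-- The entanglement of purification
`E_P(A:B) = inf { S(AA') : |Ψ⟩_{AA'BB'} purifies ρ_{AB} }` (the infimum ranging over all
finite-dimensional purifying spaces) vanishes for product states `ρ_{AB} = ρ_A ⊗ ρ_B`,
and in general `E_P(A:B) ≥ ½ I(A:B) = ½ (S(A) + S(B) - S(AB))`. -/
theorem entanglement_of_purification_product_and_mutual_info
    {A B : Type*} [Fintype A] [DecidableEq A] [Fintype B] [DecidableEq B]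
    (ρ : Matrix (A × B) (A × B) ℂ) (hρ : ρ.PosSemidef) (htr : ρ.trace = 1)
    (ρA : Matrix A A ℂ) (hρA : ρA = Matrix.of fun a a' => ∑ b, ρ (a, b) (a', b))
    (ρB : Matrix B B ℂ) (hρB : ρB = Matrix.of fun b b' => ∑ a, ρ (a, b) (a, b'))
    (EP : ℝ)
    (hEP : EP = sInf {x : ℝ | ∃ (dA : ℕ) (dB : ℕ)
      (Ψ : (A × Fin dA) × (B × Fin dB) → ℂ),
      (∀ (a a' : A) (b b' : B),
        (∑ p : Fin dA, ∑ q : Fin dB,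
          Ψ ((a, p), (b, q)) * star (Ψ ((a', p), (b', q)))) = ρ (a, b) (a', b'))
      ∧ x = vonNeumann (Matrix.of fun (r s : A × Fin dA) =>
          ∑ t : B × Fin dB, Ψ (r, t) * star (Ψ (s, t)))}) :
    (ρ = ρA ⊗ₖ ρB → EP = 0)
    ∧ (vonNeumann ρA + vonNeumann ρB - vonNeumann ρ) / 2 ≤ EP := by
  have hA' : ρA = ptA ρ := hρA
  have hB' : ρB = ptB ρ := hρB
  set S := {x : ℝ | ∃ (dA : ℕ) (dB : ℕ)
      (Ψ : (A × Fin dA) × (B × Fin dB) → ℂ),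
      (∀ (a a' : A) (b b' : B),
        (∑ p : Fin dA, ∑ q : Fin dB,
          Ψ ((a, p), (b, q)) * star (Ψ ((a', p), (b', q)))) = ρ (a, b) (a', b'))
      ∧ x = vonNeumann (Matrix.of fun (r s : A × Fin dA) =>
          ∑ t : B × Fin dB, Ψ (r, t) * star (Ψ (s, t)))} with hS
  have hne : S.Nonempty := by
    obtain ⟨C, hC⟩ := psd_factor ρ hρ
    refine ⟨_, 1, _, fun x => C (x.1.1, x.2.1) x.2.2, ?_, rfl⟩
    intro a a' b b'
    simp only [Finset.univ_unique, Finset.sum_singleton]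
    exact hC (a, b) (a', b')
  have hlow : ∀ x ∈ S, 0 ≤ x ∧ (vonNeumann ρA + vonNeumann ρB - vonNeumann ρ) / 2 ≤ x := by
    rintro x ⟨dA, dB, Ψ, hΨ, rfl⟩
    rw [hA', hB']
    exact purif_bound hρ htr Ψ hΨ
  refine ⟨?_, ?_⟩
  · intro hprod
    have hge : 0 ≤ EP := by
      rw [hEP]
      exact le_csInf hne fun x hx => (hlow x hx).1
    refine le_antisymm ?_ hge
    have hpA : ρA.PosSemidef := by rw [hA']; exact ptA_psd hρ
    have hpB : ρB.PosSemidef := by rw [hB']; exact ptB_psd hρ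
    have htA : ∑ a, ρA a a = 1 := by
      rw [← htr, hρA, Matrix.trace, Fintype.sum_prod_type]
      rfl
    have htB : ∑ b, ρB b b = 1 := by
      rw [← htr, hρB, Matrix.trace, Fintype.sum_prod_type, Finset.sum_comm]
      rfl
    obtain ⟨C, hC⟩ := psd_factor ρA hpA
    obtain ⟨D, hD⟩ := psd_factor ρB hpB
    rw [hEP]
    apply csInf_le ⟨0, fun x hx => (hlow x hx).1⟩
    refine ⟨_, _, fun x => C x.1.1 x.1.2 * D x.2.1 x.2.2, ?_, ?_⟩
    · intro a a' b b'
      rw [hprod, Matrix.kroneckerMap_apply, ← hC, ← hD, Finset.sum_mul_sum]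
      apply Finset.sum_congr rfl
      intro p _
      apply Finset.sum_congr rfl
      intro q _
      rw [star_mul']
      ring
    · have hDn : ∑ t : B × Fin (Fintype.card B), D t.1 t.2 * star (D t.1 t.2) = 1 := by
        rw [Fintype.sum_prod_type, ← htB]
        exact Finset.sum_congr rfl fun b _ => hD b b
      have hCn : ∑ t : A × Fin (Fintype.card A), C t.1 t.2 * star (C t.1 t.2) = 1 := by
        rw [Fintype.sum_prod_type, ← htA]
        exact Finset.sum_congr rfl fun b _ => hC b b
      rw [← vonNeumann_pure (fun t : A × Fin (Fintype.card A) => C t.1 t.2) hCn]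
      congr 1
      ext r s
      simp only [Matrix.of_apply]
      rw [← mul_one (C r.1 r.2 * star (C s.1 s.2)), ← hDn, Finset.mul_sum]
      apply Finset.sum_congr rfl
      intro t _
      rw [star_mul']
      ring
  · rw [hEP]
    exact le_csInf hne fun x hx => (hlow x hx).2
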